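/- arXiv:2512.17258 — 2 statements merged into one kernel-verified Lean document; each statement's English description precedes it below -/
import Mathlib

section
/- Let G = (V₁,E₁) be a connected graph with |V₁| ≥ 2, H = (V₂,E₂) an arbitrary graph with |V₂| ≥ 1, D_G the distance matrix of G, J the all-ones V₁×V₁ matrix, A_H the adjacency matrix of H, and 1 the all-ones vector in ℝ^{V₁}. Then λ ∈ λ(S_{G⊙H}) if and only if there exist μ ∈ ℝ and vectors ξ_o ∈ ℝ^{V₁} and ξ_x ∈ ℝ^{V₁} for each x ∈ V₂ satisfying: (1) (D_G − J − λI)ξ_o + Σ_{x∈V₂} D_G ξ_x = (μ/2)·1; (2) λ ξ_o = Σ_{y∈V₂} (A_H + (2+λ)I)_{x,y} ξ_y for every x ∈ V₂; (3) ⟨1, ξ_o⟩ + Σ_{x∈V₂} ⟨1, ξ_x⟩ = 0; (4) ⟨ξ_o, ξ_o⟩ + Σ_{x∈V₂} ⟨ξ_x, ξ_x⟩ = 1. -/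
open scoped BigOperators
open Filter Topology
open scoped Classical

namespace QECPaper

/-- The cone (join) `K₁ + H` over a graph `H`: vertex `none` is the apex. -/
def cone {V₂ : Type*} (H : SimpleGraph V₂) : SimpleGraph (Option V₂) where
  Adj x y := (∃ a b, x = some a ∧ y = some b ∧ H.Adj a b) ∨
    (x = none ∧ y ≠ none) ∨ (x ≠ none ∧ y = none)
  symm.symm := by
    rintro x y (⟨a, b, rfl, rfl, h⟩ | ⟨rfl, hy⟩ | ⟨hx, rfl⟩)
    · exact Or.inl ⟨b, a, rfl, rfl, h.symm⟩
    · exact Or.inr (Or.inr ⟨hy, rfl⟩)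
    · exact Or.inr (Or.inl ⟨rfl, hx⟩)
  loopless.irrefl := by
    rintro x (⟨a, b, rfl, hb, h⟩ | ⟨rfl, hy⟩ | ⟨hx, rfl⟩)
    · exact H.loopless.irrefl a (by cases hb; exact h)
    · exact hy rfl
    · exact hx rfl

/-- The corona `G ⊙ H` of two graphs, realized on `V₁ × ({o} ∪ V₂)`
with `o = none`. -/
def corona {V₁ V₂ : Type*} (G : SimpleGraph V₁) (H : SimpleGraph V₂) :
    SimpleGraph (V₁ × Option V₂) where
  Adj p q := (p.1 = q.1 ∧ (cone H).Adj p.2 q.2) ∨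
    (G.Adj p.1 q.1 ∧ p.2 = none ∧ q.2 = none)
  symm.symm := by
    rintro ⟨i, x⟩ ⟨j, y⟩ (⟨h1, h2⟩ | ⟨h1, h2, h3⟩)
    · exact Or.inl ⟨h1.symm, (cone H).symm.symm _ _ h2⟩
    · exact Or.inr ⟨h1.symm, h3, h2⟩
  loopless.irrefl := by
    rintro ⟨i, x⟩ (⟨h1, h2⟩ | ⟨h1, h2, h3⟩)
    · exact (cone H).loopless.irrefl x h2
    · exact G.loopless.irrefl i h1

/-- The quadratic embedding constant of a (connected) graph on a finite vertex set. -/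
noncomputable def QEC {V : Type*} [Fintype V] (G : SimpleGraph V) : ℝ :=
  sSup {r : ℝ | ∃ f : V → ℝ, (∑ x, f x ^ 2) = 1 ∧ (∑ x, f x) = 0 ∧
    r = ∑ x, ∑ y, f x * (G.dist x y : ℝ) * f y}

/-- The set `λ(S)` of `λ` appearing in a solution of the basic equations. -/
def lambdaS {V : Type*} [Fintype V] (G : SimpleGraph V) : Set ℝ :=
  {lam : ℝ | ∃ (f : V → ℝ) (μ : ℝ),
    (∀ x, (∑ y, (G.dist x y : ℝ) * f y) - lam * f x = μ / 2) ∧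
    (∑ x, f x) = 0 ∧ (∑ x, f x ^ 2) = 1}

/-- The distance matrix of a graph, with real entries. -/
noncomputable def distMatrix {V : Type*} (G : SimpleGraph V) : Matrix V V ℝ :=
  Matrix.of fun x y => (G.dist x y : ℝ)

section MatrixFunctions

variable {ι : Type*} [Fintype ι] [DecidableEq ι]

/-- The eigenspace `ker (A - α)` inside `EuclideanSpace ℝ ι`. -/
noncomputable def eigSpace (A : Matrix ι ι ℝ) (α : ℝ) :
    Submodule ℝ (EuclideanSpace ℝ ι) :=
  LinearMap.ker (Matrix.toEuclideanLin A - α • LinearMap.id)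

/-- The all-ones vector of `EuclideanSpace ℝ ι`. -/
noncomputable def onesE (ι : Type*) [Fintype ι] : EuclideanSpace ℝ ι :=
  (WithLp.equiv 2 (ι → ℝ)).symm (fun _ => 1)

/-- `‖E_α 𝟏‖²`, where `E_α` is the orthogonal projection of `EuclideanSpace ℝ ι`
onto the eigenspace `ker (A - α)`. -/
noncomputable def projNormSq (A : Matrix ι ι ℝ) (α : ℝ) : ℝ :=
  ‖(Submodule.orthogonalProjectionOnto (eigSpace A α) (onesE ι) : EuclideanSpace ℝ ι)‖ ^ 2

/-- The set of (real) eigenvalues of a matrix. -/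
def evSet (A : Matrix ι ι ℝ) : Set ℝ :=
  {α : ℝ | ∃ v : ι → ℝ, v ≠ 0 ∧ A.mulVec v = α • v}

/-- The set of main eigenvalues: those `α` with `E_α 𝟏 ≠ 0`. -/
def mainEv (A : Matrix ι ι ℝ) : Set ℝ := {α : ℝ | projNormSq A α ≠ 0}

/-- `k_A = |ev_M(A) \ {-2}|`. -/
noncomputable def kA (A : Matrix ι ι ℝ) : ℕ := (mainEv A \ {(-2 : ℝ)}).ncard

/-- The ω-function associated with the symmetric matrix `A`. -/
noncomputable def omegaFun (A : Matrix ι ι ℝ) (lam : ℝ) : ℝ :=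
  1 + projNormSq A (-2) +
    ∑ᶠ α ∈ mainEv A \ {(-2 : ℝ)}, lam / (α + 2 + lam) * projNormSq A α

/-- The (maximal) domain of the ω-function: the complement of its poles. -/
def omegaDomain (A : Matrix ι ι ℝ) : Set ℝ :=
  {lam : ℝ | ∀ α ∈ mainEv A \ {(-2 : ℝ)}, lam ≠ -α - 2}

/-- The set of zeroes of the ω-function (on its domain). -/
def omegaZeros (A : Matrix ι ι ℝ) : Set ℝ :=
  {lam : ℝ | lam ∈ omegaDomain A ∧ omegaFun A lam = 0}

/-- `λ*`, the largest zero of the ω-function. -/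
noncomputable def lamStar (A : Matrix ι ι ℝ) : ℝ := sSup (omegaZeros A)

/-- The ψ-function associated with `A`: `ψ_A(λ) = λ/ω_A(λ)` extended
analytically across the poles of `ω_A` by the value `0`. -/
noncomputable def psiFun (A : Matrix ι ι ℝ) (lam : ℝ) : ℝ :=
  if -lam - 2 ∈ mainEv A \ {(-2 : ℝ)} then 0 else lam / omegaFun A lam

/-- The inverse of the rightmost branch `ψ_{A*} = ψ_A ↾ (λ*, +∞)`:
`ψ_{A*}⁻¹(y)` is the unique `λ > λ*` with `ψ_A(λ) = y`. -/
noncomputable def psiStarInv (A : Matrix ι ι ℝ) (y : ℝ) : ℝ :=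
  sSup {lam : ℝ | lamStar A < lam ∧ psiFun A lam = y}

end MatrixFunctions


/-- A function on the vertices that vanishes only at `q`, changes by at most one along edges and
can be decreased by moving to a neighbor wherever it is nonzero is the distance to `q`. -/
theorem dist_eq_of_potential {V : Type*} {Γ : SimpleGraph V} {q : V} (F : V → ℕ)
    (hq : ∀ p, F p = 0 ↔ p = q) (hstep : ∀ p p', Γ.Adj p p' → F p ≤ F p' + 1)
    (hdesc : ∀ p, p ≠ q → ∃ p', Γ.Adj p p' ∧ F p' < F p) (p : V) : Γ.dist p q = F p := by
  have lower : ∀ (a b : V) (w : Γ.Walk a b), F a ≤ F b + w.length := by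
    intro a b w
    induction w with
    | nil => simp
    | cons h w ih =>
      have := hstep _ _ h
      rw [SimpleGraph.Walk.length_cons]
      omega
  have upper : ∀ (n : ℕ) (a : V), F a ≤ n → ∃ w : Γ.Walk a q, w.length ≤ n := by
    intro n
    induction n with
    | zero =>
      intro a ha
      obtain rfl := (hq a).1 (by omega)
      exact ⟨SimpleGraph.Walk.nil, by simp⟩
    | succ n ih =>
      intro a ha
      by_cases haq : a = q
      · subst haq
        exact ⟨SimpleGraph.Walk.nil, by simp⟩
      · obtain ⟨b, hab, hlt⟩ := hdesc a haq
        obtain ⟨w, hw⟩ := ih b (by omega)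
        exact ⟨SimpleGraph.Walk.cons hab w, by rw [SimpleGraph.Walk.length_cons]; omega⟩
  obtain ⟨w, hw⟩ := upper (F p) p le_rfl
  obtain ⟨w', hw'⟩ := w.reachable.exists_walk_length_eq_dist
  have h1 := SimpleGraph.dist_le w
  have h2 := lower p q w'
  rw [(hq q).2 rfl] at h2
  omega

theorem exists_adj_dist_add_one {V : Type*} {G : SimpleGraph V} (hG : G.Connected) {i j : V}
    (hij : i ≠ j) : ∃ k, G.Adj i k ∧ G.dist k j + 1 = G.dist i j := by
  obtain ⟨w, hw⟩ := hG.exists_walk_length_eq_dist i j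
  cases w with
  | nil => exact absurd rfl hij
  | @cons _ k _ h w =>
    rw [SimpleGraph.Walk.length_cons] at hw
    have h1 := SimpleGraph.dist_le w
    have h2 := hG.dist_triangle (u := i) (v := k) (w := j)
    rw [SimpleGraph.dist_eq_one_iff_adj.2 h] at h2
    exact ⟨k, h, by omega⟩

section Distance

variable {V₁ V₂ : Type*} {G : SimpleGraph V₁} {H : SimpleGraph V₂}

@[simp] theorem cone_adj_some_some {x y : V₂} :
    (cone H).Adj (some x) (some y) ↔ H.Adj x y := by
  simp [cone]

@[simp] theorem cone_adj_none_some {y : V₂} : (cone H).Adj none (some y) := by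
  simp [cone]

@[simp] theorem cone_adj_some_none {x : V₂} : (cone H).Adj (some x) none := by
  simp [cone]

theorem corona_adj {p q : V₁ × Option V₂} :
    (corona G H).Adj p q ↔ (p.1 = q.1 ∧ (cone H).Adj p.2 q.2) ∨
      (G.Adj p.1 q.1 ∧ p.2 = none ∧ q.2 = none) :=
  Iff.rfl

/-- The distance to the apex in a cone. -/
def coneHeight : Option V₂ → ℕ
  | none => 0
  | some _ => 1

/-- The distance function of the corona `G ⊙ H`, in closed form. -/
noncomputable def coronaDist (G : SimpleGraph V₁) (H : SimpleGraph V₂)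
    (p q : V₁ × Option V₂) : ℕ :=
  if p.1 = q.1 then
    if p.2 = q.2 then 0 else if (cone H).Adj p.2 q.2 then 1 else 2
  else G.dist p.1 q.1 + coneHeight p.2 + coneHeight q.2

theorem corona_dist (hG : G.Connected) (p q : V₁ × Option V₂) :
    (corona G H).dist p q = coronaDist G H p q := by
  refine dist_eq_of_potential (fun p => coronaDist G H p q) ?_ ?_ ?_ p
  · rintro ⟨i, x⟩
    obtain ⟨j, y⟩ := q
    by_cases hij : i = j
    · by_cases hxy : x = y
      · simp [coronaDist, hij, hxy]
      · simp only [coronaDist, hij, hxy, if_true, if_false, Prod.mk.injEq, true_and]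
        split_ifs <;> simp
    · have := hG.pos_dist_of_ne hij
      simp only [coronaDist, hij, if_false, Prod.mk.injEq, false_and, iff_false]
      omega
  · rintro ⟨i, x⟩ ⟨i', x'⟩ h
    obtain ⟨j, y⟩ := q
    rw [corona_adj] at h
    rcases h with ⟨rfl, h⟩ | ⟨h, rfl, rfl⟩
    · by_cases hij : i = j
      · rcases x with _ | x <;> rcases x' with _ | x' <;> rcases y with _ | y <;>
          simp_all [coronaDist] <;> split_ifs <;> simp_all
      · rcases x with _ | x <;> rcases x' with _ | x' <;>
          simp_all [coronaDist, coneHeight] <;> omega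
    · have h2 := hG.dist_triangle (u := i) (v := i') (w := j)
      have h3 : G.dist i i' = 1 := SimpleGraph.dist_eq_one_iff_adj.2 h
      by_cases hij : i = j
      · subst hij
        rcases y with _ | y <;> simp [coronaDist]
      · by_cases hij' : i' = j
        · subst hij'
          rcases y with _ | y <;> simp [coronaDist, coneHeight, hij, h3]
        · simp only [coronaDist, hij, hij', if_false]
          omega
  · rintro ⟨i, x⟩ h
    obtain ⟨j, y⟩ := q
    by_cases hij : i = j
    · subst hij
      have hxy : x ≠ y := fun e => h (by rw [e])
      by_cases ha : (cone H).Adj x y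
      · exact ⟨(i, y), Or.inl ⟨rfl, ha⟩, by simp [coronaDist, hxy, ha]⟩
      · rcases x with _ | x <;> rcases y with _ | y
        · exact absurd rfl hxy
        · exact absurd cone_adj_none_some ha
        · exact absurd cone_adj_some_none ha
        · exact ⟨(i, none), Or.inl ⟨rfl, cone_adj_some_none⟩, by simp_all [coronaDist]⟩
    · rcases x with _ | x
      · obtain ⟨k, hk, hd⟩ := exists_adj_dist_add_one hG hij
        refine ⟨(k, none), Or.inr ⟨hk, rfl, rfl⟩, ?_⟩
        by_cases hkj : k = j
        · subst hkj
          rcases y with _ | y <;> simp [coronaDist, coneHeight, hij] <;> omega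
        · simp only [coronaDist, hij, hkj, if_false]
          omega
      · exact ⟨(i, none), Or.inl ⟨rfl, cone_adj_some_none⟩, by
          simp [coronaDist, coneHeight, hij]⟩

theorem corona_dist_none_none (hG : G.Connected) (i j : V₁) :
    (corona G H).dist (i, none) (j, none) = G.dist i j := by
  by_cases hij : i = j <;> simp [corona_dist hG, coronaDist, coneHeight, hij]

theorem corona_dist_none_some (hG : G.Connected) (i j : V₁) (y : V₂) :
    (corona G H).dist (i, none) (j, some y) = G.dist i j + 1 := by
  by_cases hij : i = j <;> simp [corona_dist hG, coronaDist, coneHeight, hij]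

theorem corona_dist_some_none (hG : G.Connected) (i j : V₁) (x : V₂) :
    (corona G H).dist (i, some x) (j, none) = G.dist i j + 1 := by
  rw [SimpleGraph.dist_comm, corona_dist_none_some hG, SimpleGraph.dist_comm]

theorem corona_dist_some_some [DecidableEq V₁] [DecidableEq V₂] [DecidableRel H.Adj]
    (hG : G.Connected) (i j : V₁) (x y : V₂) :
    ((corona G H).dist (i, some x) (j, some y) : ℝ) = G.dist i j + 2 -
      if i = j then H.adjMatrix ℝ x y + 2 * (1 : Matrix V₂ V₂ ℝ) x y else 0 := by
  rw [corona_dist hG]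
  by_cases hij : i = j
  · subst hij
    by_cases hxy : x = y
    · subst hxy
      simp [coronaDist]
    · by_cases ha : H.Adj x y <;> simp [coronaDist, hxy, ha]
      norm_num
  · simp only [coronaDist, coneHeight, hij, if_false]
    push_cast
    ring

end Distance

section BasicEquations

variable {V₁ V₂ : Type*} [Fintype V₁] [Fintype V₂] {G : SimpleGraph V₁} {H : SimpleGraph V₂}

theorem sum_prod_option (g : V₁ × Option V₂ → ℝ) :
    ∑ p, g p = ∑ i, g (i, none) + ∑ x, ∑ i, g (i, some x) := by
  rw [Fintype.sum_prod_type, Finset.sum_comm (s := (Finset.univ : Finset V₂)),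
    ← Finset.sum_add_distrib]
  simp [Fintype.sum_option]

theorem corona_sum_dist_none (hG : G.Connected) (f : V₁ × Option V₂ → ℝ) (hf : ∑ p, f p = 0)
    (i : V₁) :
    ∑ q, ((corona G H).dist (i, none) q : ℝ) * f q =
      ∑ j, (G.dist i j : ℝ) * f (j, none) - ∑ j, f (j, none) +
        ∑ y, ∑ j, (G.dist i j : ℝ) * f (j, some y) := by
  rw [sum_prod_option] at hf
  rw [sum_prod_option]
  simp only [corona_dist_none_none hG, corona_dist_none_some hG, Nat.cast_add, Nat.cast_one,
    add_mul, one_mul, Finset.sum_add_distrib]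
  linarith

theorem corona_sum_dist_some [DecidableEq V₂] [DecidableRel H.Adj] (hG : G.Connected)
    (f : V₁ × Option V₂ → ℝ) (hf : ∑ p, f p = 0) (i : V₁) (x : V₂) :
    ∑ q, ((corona G H).dist (i, some x) q : ℝ) * f q =
      ∑ q, ((corona G H).dist (i, none) q : ℝ) * f q -
        ∑ y, (H.adjMatrix ℝ x y + 2 * (1 : Matrix V₂ V₂ ℝ) x y) * f (i, some y) := by
  rw [corona_sum_dist_none hG f hf]
  rw [sum_prod_option] at hf
  rw [sum_prod_option]
  simp only [corona_dist_some_none hG, corona_dist_some_some hG, Nat.cast_add, Nat.cast_one,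
    add_mul, sub_mul, ite_mul, zero_mul, one_mul, Finset.sum_add_distrib, Finset.sum_sub_distrib,
    Finset.sum_ite_eq, Finset.mem_univ, if_true, ← Finset.mul_sum]
  linarith

end BasicEquations

/-- Characterization of `λ(S_{G⊙H})` by the reformulated
basic equations. -/
theorem lambdaS_corona_iff {V₁ V₂ : Type*} [Fintype V₁] [Fintype V₂]
    [DecidableEq V₁] [DecidableEq V₂]
    (G : SimpleGraph V₁) (H : SimpleGraph V₂) [DecidableRel H.Adj]
    (hG : G.Connected) (hV₁ : 2 ≤ Fintype.card V₁) (hV₂ : 1 ≤ Fintype.card V₂)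
    (lam : ℝ) :
    lam ∈ lambdaS (corona G H) ↔
      ∃ (μ : ℝ) (ξo : V₁ → ℝ) (ξ : V₂ → V₁ → ℝ),
        ((distMatrix G - Matrix.of (fun _ _ => (1 : ℝ)) -
            lam • (1 : Matrix V₁ V₁ ℝ)).mulVec ξo +
            ∑ x : V₂, (distMatrix G).mulVec (ξ x) = fun _ => μ / 2) ∧
        (∀ x : V₂, lam • ξo =
            ∑ y : V₂, (H.adjMatrix ℝ + (2 + lam) • (1 : Matrix V₂ V₂ ℝ)) x y • ξ y) ∧
        ((∑ i, ξo i) + ∑ x : V₂, ∑ i, ξ x i = 0) ∧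
        ((∑ i, ξo i ^ 2) + ∑ x : V₂, ∑ i, ξ x i ^ 2 = 1) := by
  have hO : ∀ (μ : ℝ) (f : V₁ × Option V₂ → ℝ), ∑ p, f p = 0 →
      (((distMatrix G - Matrix.of (fun _ _ => (1 : ℝ)) -
          lam • (1 : Matrix V₁ V₁ ℝ)).mulVec (fun i => f (i, none)) +
          ∑ x : V₂, (distMatrix G).mulVec (fun i => f (i, some x)) = fun _ => μ / 2) ↔
        ∀ i, ∑ q, ((corona G H).dist (i, none) q : ℝ) * f q - lam * f (i, none) = μ / 2) := by
    intro μ f hf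
    rw [funext_iff]
    refine forall_congr' fun i => ?_
    rw [corona_sum_dist_none hG f hf]
    have e : ((distMatrix G - Matrix.of (fun _ _ => (1 : ℝ)) -
        lam • (1 : Matrix V₁ V₁ ℝ)).mulVec (fun i => f (i, none)) +
        ∑ x : V₂, (distMatrix G).mulVec (fun i => f (i, some x))) i =
        ∑ j, (G.dist i j : ℝ) * f (j, none) - ∑ j, f (j, none) +
          ∑ y, ∑ j, (G.dist i j : ℝ) * f (j, some y) - lam * f (i, none) := by
      simp only [Matrix.sub_mulVec, Matrix.smul_mulVec, Matrix.one_mulVec, Pi.add_apply,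
        Pi.sub_apply, Pi.smul_apply, Finset.sum_apply, smul_eq_mul, Matrix.mulVec, dotProduct,
        distMatrix, Matrix.of_apply, one_mul]
      ring
    rw [e]
  have hX : ∀ (f : V₁ × Option V₂ → ℝ), ∑ p, f p = 0 → ∀ (x : V₂) (i : V₁),
      (∑ y : V₂, (H.adjMatrix ℝ + (2 + lam) • (1 : Matrix V₂ V₂ ℝ)) x y •
          (fun i => f (i, some y) : V₁ → ℝ)) i =
        ∑ q, ((corona G H).dist (i, none) q : ℝ) * f q -
          ∑ q, ((corona G H).dist (i, some x) q : ℝ) * f q + lam * f (i, some x) := by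
    intro f hf x i
    have e : lam * f (i, some x) = ∑ y, lam * (1 : Matrix V₂ V₂ ℝ) x y * f (i, some y) := by
      simp [Matrix.one_apply]
    rw [corona_sum_dist_some hG f hf, sub_sub_cancel, e, ← Finset.sum_add_distrib,
      Finset.sum_apply]
    refine Finset.sum_congr rfl fun y _ => ?_
    simp only [Pi.smul_apply, Matrix.add_apply, Matrix.smul_apply, smul_eq_mul]
    ring
  constructor
  · rintro ⟨f, μ, heq, hsum, hsq⟩
    refine ⟨μ, fun i => f (i, none), fun x i => f (i, some x),
      (hO μ f hsum).2 fun i => heq _, fun x => funext fun i => ?_, ?_, ?_⟩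
    · rw [hX f hsum x i, Pi.smul_apply, smul_eq_mul]
      linarith [heq (i, none), heq (i, some x)]
    · rw [← sum_prod_option, hsum]
    · rw [← sum_prod_option fun p => f p ^ 2, hsq]
  · rintro ⟨μ, ξo, ξ, h1, h2, h3, h4⟩
    let f : V₁ × Option V₂ → ℝ := fun p => p.2.elim (ξo p.1) fun x => ξ x p.1
    have hsum : ∑ p, f p = 0 := by rw [sum_prod_option]; exact h3
    have hnone := (hO μ f hsum).1 h1
    refine ⟨f, μ, ?_, hsum, by rw [sum_prod_option]; exact h4⟩
    rintro ⟨i, _ | x⟩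
    · exact hnone i
    · have h : lam * f (i, none) = _ := (congrFun (h2 x) i).trans (hX f hsum x i)
      linarith [hnone i]

end QECPaper
end

section
/- Let A be a real symmetric n×n matrix (n ≥ 1) with k_A = |ev_M(A)\{−2}| ≥ 1, and let λ* be the largest zero of ω_A. Then λ* < 0 if min ev_M(A) ≥ −2, and λ* > 0 if min ev_M(A) < −2. -/
open scoped BigOperators
open Filter Topology
open scoped Classical

namespace QECPaper

/-- A sum of simple fractions which is positive at `0` has a zero strictly between `0` and a pole
`-(α₀ + 2)` with no other pole in between. -/
lemma exists_zero_between_zero_and_pole (S : Finset ℝ) (w : ℝ → ℝ) (c α₀ : ℝ) (hc : 0 < c)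
    (hα₀ : α₀ ∈ S) (hne : α₀ + 2 ≠ 0) (hw : 0 < w α₀)
    (hpole : ∀ α ∈ S, α ≠ α₀ → ∀ t ∈ Set.Icc (0 : ℝ) 1, α + 2 + -(α₀ + 2) * t ≠ 0) :
    ∃ t ∈ Set.Ioo (0 : ℝ) 1,
      c + ∑ α ∈ S, -(α₀ + 2) * t / (α + 2 + -(α₀ + 2) * t) * w α = 0 := by
  set g : ℝ → ℝ := fun t => c + ∑ α ∈ S, -(α₀ + 2) * t / (α + 2 + -(α₀ + 2) * t) * w α with hg
  have hpole' : ∀ α ∈ S, ∀ t ∈ Set.Ico (0 : ℝ) 1, α + 2 + -(α₀ + 2) * t ≠ 0 := by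
    intro α hα t ht
    by_cases h : α = α₀
    · have : α + 2 + -(α₀ + 2) * t = (α₀ + 2) * (1 - t) := by rw [h]; ring
      rw [this]
      exact mul_ne_zero hne (sub_ne_zero.mpr ht.2.ne')
    · exact hpole α hα h t ⟨ht.1, ht.2.le⟩
  have hcont : ContinuousOn g (Set.Ico 0 1) := by
    refine continuousOn_const.add (continuousOn_finsetSum _ fun α hα => ?_)
    exact (ContinuousOn.div (by fun_prop) (by fun_prop) (hpole' α hα)).mul continuousOn_const
  have hrest : Tendsto
      (fun t => c + ∑ α ∈ S.erase α₀, -(α₀ + 2) * t / (α + 2 + -(α₀ + 2) * t) * w α)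
      (𝓝[<] (1 : ℝ))
      (𝓝 (c + ∑ α ∈ S.erase α₀, -(α₀ + 2) * 1 / (α + 2 + -(α₀ + 2) * 1) * w α)) := by
    refine Tendsto.mono_left ?_ nhdsWithin_le_nhds
    refine tendsto_const_nhds.add (tendsto_finsetSum _ fun α hα => ?_)
    have hα' := Finset.mem_erase.mp hα
    have hd := hpole α hα'.2 hα'.1 1 ⟨zero_le_one, le_rfl⟩
    have : ContinuousAt (fun t : ℝ => -(α₀ + 2) * t / (α + 2 + -(α₀ + 2) * t) * w α) 1 := by
      fun_prop (disch := exact hd)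
    exact this
  have hsing : Tendsto (fun t : ℝ => -(α₀ + 2) * t / (α₀ + 2 + -(α₀ + 2) * t) * w α₀)
      (𝓝[<] (1 : ℝ)) atBot := by
    have hinv : Tendsto (fun t : ℝ => (t - 1)⁻¹) (𝓝[<] (1 : ℝ)) atBot := by
      refine tendsto_inv_nhdsLT_zero.comp (tendsto_nhdsWithin_iff.mpr ⟨?_, ?_⟩)
      · refine Tendsto.mono_left ?_ nhdsWithin_le_nhds
        have : ContinuousAt (fun t : ℝ => t - 1) 1 := by fun_prop
        simpa [ContinuousAt] using this
      · filter_upwards [self_mem_nhdsWithin] with t ht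
        exact sub_neg.mpr (Set.mem_Iio.mp ht)
    have hnum : Tendsto (fun t : ℝ => t * w α₀) (𝓝[<] (1 : ℝ)) (𝓝 (1 * w α₀)) :=
      (tendsto_id.mul_const _).mono_left nhdsWithin_le_nhds
    refine (hinv.atBot_mul_pos (by simpa using hw) hnum).congr' ?_
    filter_upwards [self_mem_nhdsWithin] with t ht
    have ht' : t - 1 ≠ 0 := sub_ne_zero.mpr (ne_of_lt ht)
    have : α₀ + 2 + -(α₀ + 2) * t = -(α₀ + 2) * (t - 1) := by ring
    rw [this, mul_div_mul_left _ _ (neg_ne_zero.mpr hne)]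
    field_simp
  have hlim : Tendsto g (𝓝[<] (1 : ℝ)) atBot := by
    refine (hrest.add_atBot hsing).congr fun t => ?_
    rw [add_assoc, Finset.sum_erase_add _ _ hα₀]
  obtain ⟨s, hgs, hs⟩ := ((hlim.eventually (eventually_lt_atBot 0)).and
    (Ioo_mem_nhdsLT (zero_lt_one' ℝ))).exists
  have hg0 : 0 < g 0 := by simpa [hg] using hc
  obtain ⟨t, ht, htz⟩ := intermediate_value_Ioo' hs.1.le
    (hcont.mono fun x hx => ⟨hx.1, hx.2.trans_lt hs.2⟩) ⟨hgs, hg0⟩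
  exact ⟨t, ⟨ht.1, ht.2.trans hs.2⟩, htz⟩

section OmegaFunction

variable {ι : Type*} [Fintype ι] [DecidableEq ι] {A : Matrix ι ι ℝ}

lemma projNormSq_nonneg (A : Matrix ι ι ℝ) (α : ℝ) : 0 ≤ projNormSq A α :=
  sq_nonneg _

lemma omegaFun_eq_sum {S : Finset ℝ} (hS : (S : Set ℝ) = mainEv A \ {(-2 : ℝ)}) (lam : ℝ) :
    omegaFun A lam = 1 + projNormSq A (-2) +
      ∑ α ∈ S, lam / (α + 2 + lam) * projNormSq A α := by
  rw [omegaFun, ← hS, finsum_mem_coe_finset]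

/-- There is a zero of the ω-function strictly between `0` and a pole with no other pole in
between. -/
lemma exists_mem_omegaZeros {S : Finset ℝ} (hS : (S : Set ℝ) = mainEv A \ {(-2 : ℝ)})
    {α₀ : ℝ} (hα₀ : α₀ ∈ S)
    (hpole : ∀ α ∈ S, α ≠ α₀ → ∀ t ∈ Set.Icc (0 : ℝ) 1, α + 2 + -(α₀ + 2) * t ≠ 0) :
    ∃ t ∈ Set.Ioo (0 : ℝ) 1, -(α₀ + 2) * t ∈ omegaZeros A := by
  have hmem : α₀ ∈ mainEv A \ {(-2 : ℝ)} := hS ▸ Finset.mem_coe.mpr hα₀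
  have hne : α₀ + 2 ≠ 0 := fun h => hmem.2 (eq_neg_of_add_eq_zero_left h)
  obtain ⟨t, ht, hz⟩ := exists_zero_between_zero_and_pole S (projNormSq A)
    (1 + projNormSq A (-2)) α₀ (by linarith [projNormSq_nonneg A (-2)]) hα₀ hne
    ((projNormSq_nonneg A α₀).lt_of_ne' hmem.1) hpole
  refine ⟨t, ht, fun α hα heq => ?_, (omegaFun_eq_sum hS _).trans hz⟩
  have hαS : α ∈ S := Finset.mem_coe.mp (hS ▸ hα)
  by_cases h : α = α₀
  · have : (α₀ + 2) * (1 - t) = 0 := by rw [h] at heq; linarith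
    exact mul_ne_zero hne (sub_ne_zero.mpr ht.2.ne') this
  · exact hpole α hαS h t ⟨ht.1.le, ht.2.le⟩ (by linarith)

/-- The ω-function is positive at every nonnegative point to the right of all its poles. -/
lemma omegaFun_pos {S : Finset ℝ} (hS : (S : Set ℝ) = mainEv A \ {(-2 : ℝ)}) {lam : ℝ}
    (hlam : 0 ≤ lam) (h : ∀ α ∈ S, 0 ≤ α + 2 + lam) : 0 < omegaFun A lam := by
  rw [omegaFun_eq_sum hS]
  have := Finset.sum_nonneg fun α hα =>
    mul_nonneg (div_nonneg hlam (h α hα)) (projNormSq_nonneg A α)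
  linarith [projNormSq_nonneg A (-2)]

/-- The ω-function is strictly monotone to the right of all its poles if these are negative. -/
lemma omegaFun_lt_omegaFun {S : Finset ℝ} (hS : (S : Set ℝ) = mainEv A \ {(-2 : ℝ)})
    (hne : S.Nonempty) {x y : ℝ}
    (hxy : x < y) (hpos : ∀ α ∈ S, 0 < α + 2) (hx : ∀ α ∈ S, 0 < α + 2 + x) :
    omegaFun A x < omegaFun A y := by
  rw [omegaFun_eq_sum hS, omegaFun_eq_sum hS]
  refine add_lt_add_right (Finset.sum_lt_sum_of_nonempty hne fun α hα => ?_) _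
  have hmem : α ∈ mainEv A \ {(-2 : ℝ)} := hS ▸ Finset.mem_coe.mpr hα
  refine mul_lt_mul_of_pos_right ?_ ((projNormSq_nonneg A α).lt_of_ne' hmem.1)
  have h1 := hx α hα
  rw [div_lt_div_iff₀ h1 (by linarith)]
  nlinarith [hpos α hα]

end OmegaFunction

/-- Sign of the largest zero `λ*` of the ω-function. -/
theorem lamStar_sign {n : ℕ} (hn : 1 ≤ n)
    (A : Matrix (Fin n) (Fin n) ℝ) (hA : A.IsSymm) (hk : 1 ≤ kA A) :
    ((∀ β ∈ mainEv A, -2 ≤ β) → lamStar A < 0) ∧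
    ((∃ β ∈ mainEv A, β < -2) → 0 < lamStar A) := by
  have hfin : (mainEv A \ {(-2 : ℝ)}).Finite := Set.finite_of_ncard_pos hk
  obtain ⟨S, hS⟩ := hfin.exists_finset_coe
  have hSne : S.Nonempty := by
    rw [← Finset.coe_nonempty, hS]
    exact Set.nonempty_of_ncard_ne_zero (Nat.one_le_iff_ne_zero.mp hk)
  obtain ⟨αmin, hmin, hle⟩ := S.exists_min_image id hSne
  simp only [id] at hle
  constructor
  · intro h
    have hpos : ∀ α ∈ S, 0 < α + 2 := fun α hα => by
      have hmem : α ∈ mainEv A \ {(-2 : ℝ)} := hS ▸ Finset.mem_coe.mpr hα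
      have := (h α hmem.1).lt_of_ne' hmem.2
      linarith
    have hright : ∀ t < 1, ∀ α ∈ S, 0 < α + 2 + -(αmin + 2) * t := fun t ht α hα => by
      nlinarith [hle α hα, mul_pos (hpos αmin hmin) (sub_pos.mpr ht)]
    obtain ⟨t, ht, hz⟩ := exists_mem_omegaZeros hS hmin fun α hα hne t ht => by
      have hlt := (hle α hα).lt_of_ne' hne
      nlinarith [mul_nonneg (hpos αmin hmin).le (sub_nonneg.mpr ht.2)]
    have hub : lamStar A ≤ -(αmin + 2) * t := by
      refine csSup_le ⟨_, hz⟩ fun x hx => le_of_not_gt fun hlt => ?_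
      have := omegaFun_lt_omegaFun hS hSne hlt hpos (hright t ht.2)
      rw [hz.2, hx.2] at this
      exact lt_irrefl _ this
    nlinarith [mul_pos (hpos αmin hmin) ht.1]
  · rintro ⟨β, hβ, hβ2⟩
    have hβS : β ∈ S := by
      rw [← Finset.mem_coe, hS]
      exact ⟨hβ, hβ2.ne⟩
    have hbdd : BddAbove (omegaZeros A) := by
      refine ⟨-(αmin + 2), fun x hx => le_of_not_gt fun hlt => ?_⟩
      refine (omegaFun_pos hS ?_ fun α hα => ?_).ne' hx.2
      · linarith [hle β hβS]
      · linarith [hle α hα]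
    obtain ⟨γ, hγ, hγle⟩ := (S.filter (· < -2)).exists_max_image id
      ⟨β, Finset.mem_filter.mpr ⟨hβS, hβ2⟩⟩
    obtain ⟨hγS, hγ2⟩ := Finset.mem_filter.mp hγ
    obtain ⟨t, ht, hz⟩ := exists_mem_omegaZeros hS hγS fun α hα hne t ht => by
      have hmem : α ∈ mainEv A \ {(-2 : ℝ)} := hS ▸ Finset.mem_coe.mpr hα
      rcases lt_or_gt_of_ne hmem.2 with hlt | hgt
      · have hαγ : α < γ := (hγle α (Finset.mem_filter.mpr ⟨hα, hlt⟩)).lt_of_ne hne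
        nlinarith [mul_nonneg (by linarith : 0 ≤ -(γ + 2)) (sub_nonneg.mpr ht.2)]
      · nlinarith [mul_nonneg (by linarith : 0 ≤ -(γ + 2)) ht.1]
    exact (mul_pos (by linarith) ht.1).trans_le (le_csSup hbdd hz)

end QECPaper
end
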